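/- arXiv:0712.0707 — 9 statements merged into one kernel-verified Lean document; each statement's English description precedes it below -/
import Mathlib

section
/- For every y ∈ ℝ̄ and every outcome ω ∈ Ω, one has Y(ω) > y if and only if w(S_y(ω)) > y; that is, the indicator of the event {Y > y} coincides pointwise with the indicator of the event {w(S_y) > y}. -/
open MeasureTheory Finset

/-- For every `y` and every outcome `ω`, `Y ω > y` iff `w (S_y ω) > y`,
where `S_y ω = {i : X i ω > y}` and `Y = p_w (X_1, …, X_n)`. -/
theorem stmt_0 {n : ℕ} (hn : 1 ≤ n) {Ω : Type*} [MeasurableSpace Ω]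
    (ℙ : Measure Ω) [IsProbabilityMeasure ℙ]
    (X : Fin n → Ω → EReal) (hX : ∀ i, Measurable (X i))
    (w : Finset (Fin n) → EReal) (hw : ∀ S T : Finset (Fin n), S ⊆ T → w S ≤ w T)
    (Y : Ω → EReal) (hY : ∀ ω, Y ω = ⨆ S : Finset (Fin n), (w S ⊓ ⨅ i ∈ S, X i ω))
    (y : EReal) (ω : Ω) :
    Y ω > y ↔ w (Finset.univ.filter (fun i => X i ω > y)) > y := by
  rw [hY ω, gt_iff_lt, gt_iff_lt, lt_iSup_iff]
  constructor
  · rintro ⟨S, hS⟩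
    obtain ⟨hwS, hXS⟩ := lt_inf_iff.mp hS
    refine hwS.trans_le (hw _ _ fun i hi => ?_)
    exact Finset.mem_filter.mpr ⟨Finset.mem_univ i, hXS.trans_le (iInf₂_le i hi)⟩
  · intro h
    refine ⟨_, lt_inf_iff.mpr ⟨h, ?_⟩⟩
    rw [← Finset.inf_eq_iInf, Finset.lt_inf_iff (h.trans_le le_top)]
    exact fun i hi => (Finset.mem_filter.mp hi).2
end

section
/- For every y ∈ ℝ̄, 1 − F_Y(y) = Σ_{S ⊆ {1,…,n}} Ind(w(S) > y) · ℙ(S_y = S); equivalently, ℙ(Y > y) equals the sum of ℙ({i : X_i > y} = S) over those subsets S with w(S) > y. -/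
open MeasureTheory Finset

/-- A weighted lattice polynomial exceeds `y` iff the weight of the set of coordinates exceeding `y`
does. -/
lemma lt_iSup_inf_iInf_iff {ι α : Type*} [CompleteLinearOrder α]
    {w : Finset ι → α} (hw : Monotone w) (x : ι → α) (y : α) {T : Finset ι}
    (hT : ∀ i, y < x i ↔ i ∈ T) :
    y < ⨆ S : Finset ι, (w S ⊓ ⨅ i ∈ S, x i) ↔ y < w T := by
  simp only [lt_iSup_iff, lt_inf_iff, ← Finset.inf_eq_iInf]
  constructor
  · rintro ⟨S, hS, hx⟩
    exact hS.trans_le (hw fun i hi => (hT i).1 (hx.trans_le (Finset.inf_le hi)))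
  · intro h
    exact ⟨T, h, (Finset.lt_inf_iff (h.trans_le le_top)).2 fun i hi => (hT i).2 hi⟩

/-- `1 − F_Y(y) = Σ_{S ⊆ [n]} Ind(w(S) > y) · ℙ(S_y = S)`. -/
theorem stmt_1 {n : ℕ} (hn : 1 ≤ n) {Ω : Type*} [MeasurableSpace Ω]
    (ℙ : Measure Ω) [IsProbabilityMeasure ℙ]
    (X : Fin n → Ω → EReal) (hX : ∀ i, Measurable (X i))
    (w : Finset (Fin n) → EReal) (hw : ∀ S T : Finset (Fin n), S ⊆ T → w S ≤ w T)
    (Y : Ω → EReal) (hY : ∀ ω, Y ω = ⨆ S : Finset (Fin n), (w S ⊓ ⨅ i ∈ S, X i ω))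
    (y : EReal) :
    1 - (ℙ {ω | Y ω ≤ y}).toReal =
      ∑ S : Finset (Fin n),
        (if w S > y then (1 : ℝ) else 0) *
          (ℙ {ω | ∀ i, X i ω > y ↔ i ∈ S}).toReal := by
  set E : Finset (Fin n) → Set Ω := fun S => {ω | ∀ i, X i ω > y ↔ i ∈ S}
  have hEm : ∀ S, MeasurableSet (E S) := fun S => by
    simp only [E, Set.ofPred_forall]
    exact MeasurableSet.iInter fun i =>
      (measurableSet_lt measurable_const (hX i)).iff (MeasurableSet.const (i ∈ S))
  have hdisj : Pairwise (Function.onFun Disjoint E) := by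
    intro S T hST
    refine Set.disjoint_left.2 fun ω hS hT => hST ?_
    ext i
    exact (hS i).symm.trans (hT i)
  have hgt : {ω | Y ω ≤ y}ᶜ = ⋃ S ∈ univ.filter (fun S => y < w S), E S := by
    ext ω
    simp only [Set.mem_compl_iff, Set.mem_ofPred_eq, not_le, hY, Set.mem_iUnion, mem_filter,
      mem_univ, true_and, exists_prop]
    constructor
    · intro h
      have hT : ∀ i, y < X i ω ↔ i ∈ univ.filter (fun i => y < X i ω) := by simp
      exact ⟨_, (lt_iSup_inf_iInf_iff hw (X · ω) y hT).1 h, hT⟩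
    · rintro ⟨S, hS, hT⟩
      exact (lt_iSup_inf_iInf_iff hw (X · ω) y hT).2 hS
  have hmeas : MeasurableSet {ω | Y ω ≤ y} := by
    rw [← MeasurableSet.compl_iff, hgt]
    exact Finset.measurableSet_biUnion _ fun S _ => hEm S
  change 1 - ℙ.real {ω | Y ω ≤ y} = ∑ S, (if y < w S then (1 : ℝ) else 0) * ℙ.real (E S)
  rw [← probReal_compl_eq_one_sub hmeas, hgt,
    measureReal_biUnion_finset (fun S _ T _ h => hdisj h) (fun S _ => hEm S), sum_filter]
  simp only [ite_mul, one_mul, zero_mul]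
end

section
/- Suppose the set function w takes only the values −∞ and +∞, with w(∅) = −∞ and w({1,…,n}) = +∞ (so that p_w is a lattice polynomial). Then for every y ∈ ℝ̄, 1 − F_Y(y) = Σ_{S ⊆ {1,…,n} : w(S) = +∞} ℙ(S_y = S). -/
open MeasureTheory Finset

/-- A weighted lattice polynomial with a monotone weight taking only the values `⊥` and `⊤`
exceeds `y` exactly when the set of coordinates exceeding `y` has weight `⊤`. -/
theorem lt_iSup_weight_inf_iff {ι α : Type*} [CompleteLinearOrder α] [Nontrivial α]
    {w : Finset ι → α} (hw : Monotone w) (hw01 : ∀ S, w S = ⊥ ∨ w S = ⊤) (hwbot : w ∅ = ⊥)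
    (x : ι → α) {y : α} {S : Finset ι} (hS : ∀ i, y < x i ↔ i ∈ S) :
    y < ⨆ T : Finset ι, (w T ⊓ ⨅ i ∈ T, x i) ↔ w S = ⊤ := by
  rw [lt_iSup_iff]
  constructor
  · rintro ⟨T, hT⟩
    rw [lt_inf_iff] at hT
    have hwT : w T = ⊤ := (hw01 T).resolve_left (ne_bot_of_gt hT.1)
    have hTS : T ⊆ S := fun i hi => (hS i).1 (hT.2.trans_le (iInf₂_le i hi))
    exact top_le_iff.1 (hwT ▸ hw hTS)
  · intro h
    refine ⟨S, ?_⟩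
    have hy : y < ⊤ := by
      rcases S.eq_empty_or_nonempty with rfl | ⟨i, hi⟩
      · exact absurd (hwbot.symm.trans h) bot_ne_top
      · exact ((hS i).2 hi).trans_le le_top
    rw [h, top_inf_eq, ← Finset.inf_eq_iInf, Finset.lt_inf_iff hy]
    exact fun i hi => (hS i).2 hi

/-- if `w` takes only the values `−∞ = ⊥` and `+∞ = ⊤`, with `w ∅ = ⊥` and
`w [n] = ⊤` (so `p_w` is a lattice polynomial), then
`1 − F_Y(y) = Σ_{S : w(S) = ⊤} ℙ(S_y = S)`. -/
theorem stmt_6 {n : ℕ} (hn : 1 ≤ n) {Ω : Type*} [MeasurableSpace Ω]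
    (ℙ : Measure Ω) [IsProbabilityMeasure ℙ]
    (X : Fin n → Ω → EReal) (hX : ∀ i, Measurable (X i))
    (w : Finset (Fin n) → EReal) (hw : ∀ S T : Finset (Fin n), S ⊆ T → w S ≤ w T)
    (hw01 : ∀ S : Finset (Fin n), w S = ⊥ ∨ w S = ⊤)
    (hwbot : w ∅ = ⊥) (hwtop : w Finset.univ = ⊤)
    (Y : Ω → EReal) (hY : ∀ ω, Y ω = ⨆ S : Finset (Fin n), (w S ⊓ ⨅ i ∈ S, X i ω))
    (y : EReal) :
    1 - (ℙ {ω | Y ω ≤ y}).toReal =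
      ∑ S ∈ Finset.univ.filter (fun S : Finset (Fin n) => w S = ⊤),
        (ℙ {ω | ∀ i, X i ω > y ↔ i ∈ S}).toReal := by
  set E : Finset (Fin n) → Set Ω := fun S => {ω | ∀ i, X i ω > y ↔ i ∈ S}
  have hEmeas : ∀ S, MeasurableSet (E S) := by
    intro S
    simp only [E, Set.ofPred_forall]
    refine MeasurableSet.iInter fun i => ?_
    by_cases hi : i ∈ S
    · simpa [hi] using measurableSet_lt measurable_const (hX i)
    · simpa [hi] using measurableSet_le (hX i) measurable_const
  have hdisj : Pairwise (Function.onFun Disjoint E) := by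
    intro S T hST
    refine Set.disjoint_left.2 fun ω hS hT => hST ?_
    ext i
    exact (hS i).symm.trans (hT i)
  have hunion : {ω | Y ω ≤ y} = (⋃ S ∈ Finset.univ.filter (fun S => w S = ⊤), E S)ᶜ := by
    ext ω
    have key : ∀ S, ω ∈ E S → (y < Y ω ↔ w S = ⊤) := fun S hS => by
      rw [hY]
      exact lt_iSup_weight_inf_iff (fun S T h => hw S T h) hw01 hwbot (fun i => X i ω) hS
    rw [Set.mem_ofPred_eq, Set.mem_compl_iff, ← not_lt, not_iff_not]
    simp only [Set.mem_iUnion, Finset.mem_filter, Finset.mem_univ, true_and, exists_prop]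
    refine ⟨fun h => ?_, fun ⟨S, hS, hωS⟩ => (key S hωS).2 hS⟩
    have hω : ω ∈ E (Finset.univ.filter fun i => y < X i ω) := fun i => by simp
    exact ⟨_, (key _ hω).1 h, hω⟩
  have hmeas : MeasurableSet (⋃ S ∈ Finset.univ.filter (fun S => w S = ⊤), E S) :=
    Finset.measurableSet_biUnion _ fun S _ => hEmeas S
  change 1 - ℙ.real {ω | Y ω ≤ y} = ∑ S ∈ _, ℙ.real (E S)
  rw [hunion, probReal_compl_eq_one_sub hmeas, sub_sub_cancel,
    measureReal_biUnion_finset (hdisj.set_pairwise _) fun S _ => hEmeas S]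
end

section
/- Let w : 2^{{1,…,n}} → ℝ̄ be nondecreasing with respect to inclusion. The weighted lattice polynomial p_w is a symmetric function (invariant under every permutation of its n arguments) if and only if w is cardinality-based, i.e., |S| = |S'| implies w(S) = w(S') for all S, S' ⊆ {1,…,n}. -/
open Finset

theorem iSup_inf_iInf_indicator {α L : Type*} [CompleteLattice L] {w : Finset α → L}
    (hw : Monotone w) (T : Finset α) {x : α → L} (hx_mem : ∀ i ∈ T, x i = ⊤)
    (hx_notMem : ∀ i ∉ T, x i = ⊥) :
    ⨆ S : Finset α, (w S ⊓ ⨅ i ∈ S, x i) = w T := by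
  apply le_antisymm
  · refine iSup_le fun S => ?_
    by_cases hS : S ⊆ T
    · exact inf_le_left.trans (hw hS)
    · obtain ⟨i, hiS, hiT⟩ := not_subset.mp hS
      calc w S ⊓ ⨅ i ∈ S, x i ≤ x i := inf_le_right.trans (iInf₂_le i hiS)
        _ = ⊥ := hx_notMem i hiT
        _ ≤ w T := bot_le
  · exact le_iSup_of_le T (le_inf le_rfl (le_iInf₂ fun i hi => (hx_mem i hi).symm ▸ le_top))

theorem exists_perm_mem_iff_of_card_eq {α : Type*} [Finite α] {S T : Finset α}
    (h : S.card = T.card) : ∃ σ : Equiv.Perm α, ∀ i, σ i ∈ T ↔ i ∈ S := by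
  classical
  have e : {i // i ∈ S} ≃ {i // i ∈ T} := Finset.equivOfCardEq h
  exact ⟨e.extendSubtype, fun i =>
    ⟨fun hi => by_contra fun hiS => e.extendSubtype_not_mem i hiS hi, e.extendSubtype_mem i⟩⟩

/-- for nondecreasing `w`, the weighted lattice polynomial `p_w` is a
symmetric function iff `w` is cardinality-based. -/
theorem stmt_8 {n : ℕ} (hn : 1 ≤ n)
    (w : Finset (Fin n) → EReal) (hw : ∀ S T : Finset (Fin n), S ⊆ T → w S ≤ w T) :
    (∀ (σ : Equiv.Perm (Fin n)) (x : Fin n → EReal),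
        (⨆ S : Finset (Fin n), (w S ⊓ ⨅ i ∈ S, x (σ i))) =
          ⨆ S : Finset (Fin n), (w S ⊓ ⨅ i ∈ S, x i)) ↔
      (∀ S S' : Finset (Fin n), S.card = S'.card → w S = w S') := by
  have hmono : Monotone w := fun S T h => hw S T h
  constructor
  · intro h S T hST
    obtain ⟨σ, hσ⟩ := exists_perm_mem_iff_of_card_eq hST
    have key := h σ fun i => if i ∈ T then ⊤ else ⊥
    rwa [iSup_inf_iInf_indicator hmono S (by simp +contextual [hσ])
        (by simp +contextual [hσ]),
      iSup_inf_iInf_indicator hmono T (by simp +contextual)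
        (by simp +contextual)] at key
  · intro h σ x
    refine Equiv.iSup_congr σ.finsetCongr fun S => ?_
    rw [h (σ.finsetCongr S) S (by simp)]
    congr 1
    rw [← σ.iInf_comp]
    simp
end

section
/- Suppose w(S) = m(|S|) for a nondecreasing function m : {0,1,…,n} → ℝ̄. Then for every x ∈ ℝ̄^n, p_w(x) = ⋁_{s=0}^n [ m(s) ∧ f_{n−s+1}(x) ], where for k ∈ {1,…,n} the kth order statistic function is f_k(x) = ⋁_{S ⊆ {1,…,n}, |S| = n−k+1} ⋀_{i∈S} x_i (the kth smallest coordinate) and f_{n+1} ≡ +∞. -/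
open Finset

/-- if `w S = m |S|` for a nondecreasing `m`, then
`p_w x = ⋁_{s=0}^n [ m s ⊓ f_{n−s+1} x ]`, where `f_k` is the `k`th order statistic
function (`f_k x = ⋁_{|S| = n−k+1} ⋀_{i∈S} x i`) and `f_{n+1} ≡ +∞ = ⊤`. -/
theorem stmt_9 {n : ℕ} (hn : 1 ≤ n)
    (w : Finset (Fin n) → EReal) (hw : ∀ S T : Finset (Fin n), S ⊆ T → w S ≤ w T)
    (m : ℕ → EReal) (hm : ∀ s t, s ≤ t → t ≤ n → m s ≤ m t)
    (hwm : ∀ S : Finset (Fin n), w S = m S.card)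
    (f : ℕ → (Fin n → EReal) → EReal)
    (hf : ∀ k, 1 ≤ k → k ≤ n → ∀ x, f k x =
      ⨆ S ∈ Finset.univ.filter (fun S : Finset (Fin n) => S.card = n - k + 1), ⨅ i ∈ S, x i)
    (hftop : ∀ x, f (n + 1) x = ⊤)
    (x : Fin n → EReal) :
    (⨆ S : Finset (Fin n), (w S ⊓ ⨅ i ∈ S, x i)) =
      ⨆ s ∈ Finset.range (n + 1), (m s ⊓ f (n - s + 1) x) := by
  have hf_card : ∀ s ≤ n, f (n - s + 1) x =
      ⨆ (S : Finset (Fin n)) (_ : S.card = s), ⨅ i ∈ S, x i := by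
    intro s hs
    rcases Nat.eq_zero_or_pos s with rfl | hpos
    · simp [hftop]
    · rw [hf _ (by omega) (by omega), show n - (n - s + 1) + 1 = s by omega]
      simp
  apply le_antisymm
  · refine iSup_le fun S => ?_
    have hS : S.card ≤ n := by simpa using S.card_le_univ
    refine le_iSup₂_of_le S.card (Finset.mem_range.2 (Nat.lt_succ_of_le hS)) ?_
    rw [hwm, hf_card _ hS]
    exact inf_le_inf_left _ (le_iSup₂_of_le S rfl le_rfl)
  · refine iSup₂_le fun s hs => ?_
    rw [hf_card s (Nat.le_of_lt_succ (Finset.mem_range.1 hs)), inf_iSup₂_eq]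
    refine iSup₂_le fun S hS => le_iSup_of_le S ?_
    rw [hwm, hS]
end

section
/- For every y ∈ ℝ̄ and every s ∈ {0,1,…,n}, ℙ(#{i : X_i > y} = s) = Σ_{T ⊆ {1,…,n}, |T| ≤ s} (−1)^{s−|T|} · C(n−|T|, s−|T|) · ℙ(X_i ≤ y for every i ∈ {1,…,n} \ T), where C(·,·) denotes the binomial coefficient. -/
open MeasureTheory Finset

theorem sum_Icc_neg_one_pow_card {α : Type*} [DecidableEq α] (A U : Finset α) (h : A ⊆ U) :
    ∑ T ∈ Finset.Icc A U, (-1 : ℤ) ^ (U.card - T.card) = if U = A then 1 else 0 := by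
  have key : ∑ T ∈ Finset.Icc A U, (-1 : ℤ) ^ (U.card - T.card) =
      ∑ V ∈ (U \ A).powerset, (-1 : ℤ) ^ V.card := by
    refine Finset.sum_bij' (fun T _ => U \ T) (fun V _ => U \ V) ?_ ?_ ?_ ?_ ?_
    · intro T hT
      rw [Finset.mem_Icc] at hT
      exact Finset.mem_powerset.2 (Finset.sdiff_subset_sdiff le_rfl hT.1)
    · intro V hV
      rw [Finset.mem_powerset] at hV
      rw [Finset.mem_Icc]
      exact ⟨fun x hx => Finset.mem_sdiff.2
        ⟨h hx, fun hxV => (Finset.mem_sdiff.1 (hV hxV)).2 hx⟩, Finset.sdiff_subset⟩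
    · intro T hT
      exact Finset.sdiff_sdiff_eq_self (Finset.mem_Icc.1 hT).2
    · intro V hV
      exact Finset.sdiff_sdiff_eq_self ((Finset.mem_powerset.1 hV).trans Finset.sdiff_subset)
    · intro T hT
      rw [Finset.card_sdiff_of_subset (Finset.mem_Icc.1 hT).2]
  rw [key, Finset.sum_powerset_neg_one_pow_card]
  refine if_congr ?_ rfl rfl
  rw [Finset.sdiff_eq_empty_iff_subset]
  exact ⟨fun h' => h'.antisymm h, fun h' => h'.le⟩

theorem card_filter_superset_card_eq {α : Type*} [Fintype α] [DecidableEq α] (T : Finset α)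
    {s : ℕ} (hT : T.card ≤ s) :
    (Finset.univ.filter (fun U : Finset α => T ⊆ U ∧ U.card = s)).card =
      Nat.choose (Fintype.card α - T.card) (s - T.card) := by
  rw [← Finset.card_compl, ← Finset.card_powersetCard]
  refine Finset.card_bij' (fun U _ => U \ T) (fun V _ => T ∪ V) ?_ ?_ ?_ ?_
  · intro U hU
    obtain ⟨h1, h2⟩ := (Finset.mem_filter.1 hU).2
    rw [Finset.mem_powersetCard, Finset.card_sdiff_of_subset h1, h2]
    exact ⟨fun x hx => Finset.mem_compl.2 (Finset.mem_sdiff.1 hx).2, rfl⟩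
  · intro V hV
    obtain ⟨h1, h2⟩ := Finset.mem_powersetCard.1 hV
    have hd : Disjoint T V :=
      Finset.disjoint_right.2 fun x hx => Finset.mem_compl.1 (h1 hx)
    refine Finset.mem_filter.2 ⟨Finset.mem_univ _, Finset.subset_union_left, ?_⟩
    rw [Finset.card_union_of_disjoint hd, h2]
    omega
  · intro U hU
    exact Finset.union_sdiff_of_subset (Finset.mem_filter.1 hU).2.1
  · intro V hV
    have hd : Disjoint T V :=
      Finset.disjoint_right.2 fun x hx => Finset.mem_compl.1 ((Finset.mem_powersetCard.1 hV).1 hx)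
    exact Finset.union_sdiff_cancel_left hd

theorem sum_superset_neg_one_pow_mul_choose {α : Type*} [Fintype α] [DecidableEq α]
    (A : Finset α) (s : ℕ) :
    ∑ T ∈ Finset.univ.filter (fun T : Finset α => T.card ≤ s),
        (-1 : ℤ) ^ (s - T.card) * (Nat.choose (Fintype.card α - T.card) (s - T.card) : ℤ) *
          (if A ⊆ T then 1 else 0) = if A.card = s then 1 else 0 := by
  calc
    _ = ∑ T ∈ Finset.univ.filter (fun T : Finset α => T.card ≤ s ∧ A ⊆ T),
        ∑ U ∈ Finset.univ.filter (fun U : Finset α => T ⊆ U ∧ U.card = s),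
          (-1 : ℤ) ^ (s - T.card) := by
      rw [← Finset.filter_filter, Finset.sum_filter (fun T : Finset α => A ⊆ T)]
      refine Finset.sum_congr rfl fun T hT => ?_
      rw [Finset.sum_const, card_filter_superset_card_eq T (Finset.mem_filter.1 hT).2]
      split_ifs <;> simp [mul_comm]
    _ = ∑ U ∈ Finset.univ.filter (fun U : Finset α => A ⊆ U ∧ U.card = s),
        ∑ T ∈ Finset.Icc A U, (-1 : ℤ) ^ (U.card - T.card) := by
      rw [Finset.sum_comm' (t' := Finset.univ.filter (fun U : Finset α => A ⊆ U ∧ U.card = s))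
        (s' := fun U => Finset.Icc A U)]
      · refine Finset.sum_congr rfl fun U hU => ?_
        rw [(Finset.mem_filter.1 hU).2.2]
      · intro T U
        simp only [Finset.mem_filter, Finset.mem_univ, true_and, Finset.mem_Icc]
        constructor
        · rintro ⟨⟨-, h1⟩, h2, h3⟩
          exact ⟨⟨h1, h2⟩, h1.trans h2, h3⟩
        · rintro ⟨⟨h1, h2⟩, -, h3⟩
          exact ⟨⟨h3 ▸ Finset.card_le_card h2, h1⟩, h2, h3⟩
    _ = ∑ U ∈ Finset.univ.filter (fun U : Finset α => A ⊆ U ∧ U.card = s),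
        if U = A then 1 else 0 :=
      Finset.sum_congr rfl fun U hU =>
        sum_Icc_neg_one_pow_card A U (Finset.mem_filter.1 hU).2.1
    _ = _ := by
      rw [Finset.sum_ite_eq']
      simp

/-- `ℙ(#{i : X_i > y} = s) =
Σ_{T ⊆ [n], |T| ≤ s} (−1)^{s−|T|} · C(n−|T|, s−|T|) · ℙ(X_i ≤ y for every i ∉ T)`. -/
theorem stmt_12 {n : ℕ} (hn : 1 ≤ n) {Ω : Type*} [MeasurableSpace Ω]
    (ℙ : Measure Ω) [IsProbabilityMeasure ℙ]
    (X : Fin n → Ω → EReal) (hX : ∀ i, Measurable (X i))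
    (y : EReal) (s : ℕ) (hs : s ≤ n) :
    (ℙ {ω | (Finset.univ.filter (fun i => X i ω > y)).card = s}).toReal =
      ∑ T ∈ Finset.univ.filter (fun T : Finset (Fin n) => T.card ≤ s),
        (-1 : ℝ) ^ (s - T.card) * (Nat.choose (n - T.card) (s - T.card) : ℝ) *
          (ℙ {ω | ∀ i, i ∉ T → X i ω ≤ y}).toReal := by
  have hT : ∀ T : Finset (Fin n), MeasurableSet {ω | ∀ i, i ∉ T → X i ω ≤ y} := by
    intro T
    simp only [Set.ofPred_forall]
    exact MeasurableSet.iInter fun i => MeasurableSet.iInter fun _ =>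
      measurableSet_le (hX i) measurable_const
  have hpt : ∀ ω, {ω | (Finset.univ.filter (fun i => X i ω > y)).card = s}.indicator
      (1 : Ω → ℝ) ω = ∑ T ∈ Finset.univ.filter (fun T : Finset (Fin n) => T.card ≤ s),
        (-1 : ℝ) ^ (s - T.card) * (Nat.choose (n - T.card) (s - T.card) : ℝ) *
          {ω | ∀ i, i ∉ T → X i ω ≤ y}.indicator (1 : Ω → ℝ) ω := by
    intro ω
    have h := congrArg (Int.cast : ℤ → ℝ)
      (sum_superset_neg_one_pow_mul_choose (Finset.univ.filter (fun i => X i ω > y)) s)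
    push_cast [Fintype.card_fin] at h
    simp only [Set.indicator_apply, Set.mem_ofPred_eq, Pi.one_apply]
    rw [← h]
    refine Finset.sum_congr rfl fun T _ => ?_
    congr 1
    refine if_congr ?_ rfl rfl
    simp only [Finset.subset_iff, Finset.mem_filter, Finset.mem_univ, true_and]
    exact forall_congr' fun i => by rw [← not_lt, not_imp_not]
  have hS : MeasurableSet {ω | (Finset.univ.filter (fun i => X i ω > y)).card = s} := by
    have hm : Measurable fun ω => (Finset.univ.filter (fun i => X i ω > y)).card := by
      simp only [Finset.card_filter]
      exact Finset.measurable_sum _ fun i _ =>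
        Measurable.ite (measurableSet_lt measurable_const (hX i))
          measurable_const measurable_const
    exact hm (measurableSet_singleton s)
  simp only [← measureReal_def]
  rw [← integral_indicator_one hS, funext hpt, integral_finsetSum]
  · refine Finset.sum_congr rfl fun T _ => ?_
    rw [integral_const_mul, integral_indicator_one (hT T)]
  · intro T _
    exact ((integrable_const (1 : ℝ)).indicator (hT T)).const_mul _
end

section
/- For every k ∈ {1,…,n} and every y ∈ ℝ̄, F_{(k)}(y) = Σ_{S ⊆ {1,…,n}, |S| ≥ k} (−1)^{|S|−k} · C(|S|−1, k−1) · ℙ(X_i ≤ y for every i ∈ S), where C(·,·) denotes the binomial coefficient. -/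
open MeasureTheory Finset

/-- Orthogonality of the alternating binomial sums, summed over the subsets of a finset. -/
theorem sum_powerset_neg_one_pow_mul_choose {α : Type*} [DecidableEq α] (T : Finset α) (j : ℕ) :
    ∑ S ∈ T.powerset, (-1 : ℝ) ^ S.card * (S.card.choose j : ℝ) =
      if T.card = j then (-1 : ℝ) ^ j else 0 := by
  induction T using Finset.induction_on generalizing j with
  | empty => cases j <;> simp
  | insert a T ha ih =>
    have hcard : ∀ S ∈ T.powerset, (insert a S).card = S.card + 1 := fun S hS =>
      Finset.card_insert_of_notMem fun h => ha (Finset.mem_powerset.1 hS h)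
    rw [Finset.sum_powerset_insert ha, ← Finset.sum_add_distrib, Finset.card_insert_of_notMem ha]
    cases j with
    | zero =>
      rw [if_neg (Nat.succ_ne_zero _)]
      refine Finset.sum_eq_zero fun S hS => ?_
      rw [hcard S hS, Nat.choose_zero_right, Nat.choose_zero_right]
      ring
    | succ j =>
      have hterm : ∀ S ∈ T.powerset,
          (-1 : ℝ) ^ S.card * (S.card.choose (j + 1) : ℝ) +
            (-1 : ℝ) ^ (insert a S).card * ((insert a S).card.choose (j + 1) : ℝ) =
          -((-1 : ℝ) ^ S.card * (S.card.choose j : ℝ)) := fun S hS => by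
        rw [hcard S hS, Nat.choose_succ_succ]
        push_cast
        ring
      rw [Finset.sum_congr rfl hterm, Finset.sum_neg_distrib, ih]
      by_cases h : T.card = j <;> simp [h, pow_succ]

/-- Inclusion-exclusion coefficients for the event "at least `j + 1` elements". -/
theorem sum_powerset_filter_choose_pred {α : Type*} [DecidableEq α] (T : Finset α) (j : ℕ) :
    ∑ S ∈ T.powerset, (if j + 1 ≤ S.card then
        (-1 : ℝ) ^ (S.card - (j + 1)) * ((S.card - 1).choose j : ℝ) else 0) =
      if j + 1 ≤ T.card then 1 else 0 := by
  induction T using Finset.induction_on with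
  | empty => simp
  | insert a T ha ih =>
    have hterm : ∀ S ∈ T.powerset,
        (if j + 1 ≤ (insert a S).card then (-1 : ℝ) ^ ((insert a S).card - (j + 1)) *
          (((insert a S).card - 1).choose j : ℝ) else 0) =
        (-1 : ℝ) ^ j * ((-1 : ℝ) ^ S.card * (S.card.choose j : ℝ)) := fun S hS => by
      rw [Finset.card_insert_of_notMem fun h => ha (Finset.mem_powerset.1 hS h),
        Nat.add_sub_cancel, Nat.add_sub_add_right]
      by_cases h : j ≤ S.card
      · obtain ⟨d, hd⟩ := Nat.exists_eq_add_of_le h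
        rw [if_pos (Nat.succ_le_succ h), hd, Nat.add_sub_cancel_left, pow_add, ← mul_assoc,
          ← mul_assoc, ← mul_pow]
        simp
      · rw [if_neg (by omega), Nat.choose_eq_zero_of_lt (by omega)]
        simp
    rw [Finset.sum_powerset_insert ha, ih, Finset.sum_congr rfl hterm, ← Finset.mul_sum,
      sum_powerset_neg_one_pow_mul_choose, Finset.card_insert_of_notMem ha]
    rcases lt_trichotomy T.card j with h | h | h
    · rw [if_neg (by omega), if_neg (by omega), if_neg (by omega)]
      simp
    · rw [if_neg (by omega), if_pos h, if_pos (by omega), ← mul_pow]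
      simp
    · rw [if_pos (by omega), if_neg (by omega), if_pos (by omega)]
      simp

/-- The `k`th smallest coordinate is at most `y` iff at least `k` coordinates are. -/
theorem iSup_iInf_le_iff_le_card {α : Type*} [CompleteLinearOrder α] {n k : ℕ} (hkn : k ≤ n)
    (x : Fin n → α) (y : α) :
    (⨆ S ∈ Finset.univ.filter (fun S : Finset (Fin n) => S.card = n - k + 1), ⨅ i ∈ S, x i) ≤ y ↔
      k ≤ (Finset.univ.filter fun i => x i ≤ y).card := by
  have hcompl := Finset.card_filter_add_card_filter_not (s := (Finset.univ : Finset (Fin n)))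
    (fun i => x i ≤ y)
  rw [Finset.card_univ, Fintype.card_fin] at hcompl
  simp only [iSup_le_iff, Finset.mem_filter, Finset.mem_univ, true_and]
  constructor
  · intro h
    by_contra hlt
    obtain ⟨S, hS, hScard⟩ := Finset.exists_subset_card_eq
      (s := Finset.univ.filter fun i => ¬ x i ≤ y) (n := n - k + 1) (by omega)
    obtain ⟨i, hi, hmin⟩ := S.exists_mem_eq_inf (Finset.card_pos.1 (by omega)) x
    refine (Finset.mem_filter.1 (hS hi)).2 ?_
    rw [← hmin, Finset.inf_eq_iInf]
    exact h S hScard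
  · intro h S hS
    by_contra hlt
    have hsub : S ⊆ Finset.univ.filter fun i => ¬ x i ≤ y := fun i hi =>
      Finset.mem_filter.2 ⟨Finset.mem_univ i, fun hi' => hlt ((iInf₂_le i hi).trans hi')⟩
    have := Finset.card_le_card hsub
    omega

/-- `F_{(k)}(y) = Σ_{S ⊆ [n], |S| ≥ k} (−1)^{|S|−k} · C(|S|−1, k−1) ·
ℙ(X_i ≤ y for every i ∈ S)`. -/
theorem stmt_15 {n : ℕ} (hn : 1 ≤ n) {Ω : Type*} [MeasurableSpace Ω]
    (ℙ : Measure Ω) [IsProbabilityMeasure ℙ]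
    (X : Fin n → Ω → EReal) (hX : ∀ i, Measurable (X i))
    (k : ℕ) (hk1 : 1 ≤ k) (hkn : k ≤ n) (y : EReal) :
    (ℙ {ω | (⨆ S ∈ Finset.univ.filter (fun S : Finset (Fin n) => S.card = n - k + 1),
        ⨅ i ∈ S, X i ω) ≤ y}).toReal =
      ∑ S ∈ Finset.univ.filter (fun S : Finset (Fin n) => k ≤ S.card),
        (-1 : ℝ) ^ (S.card - k) * (Nat.choose (S.card - 1) (k - 1) : ℝ) *
          (ℙ {ω | ∀ i ∈ S, X i ω ≤ y}).toReal := by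
  obtain ⟨j, rfl⟩ := Nat.exists_eq_add_of_le' hk1
  have hmeas : ∀ S : Finset (Fin n), MeasurableSet {ω | ∀ i ∈ S, X i ω ≤ y} := fun S => by
    simp only [Set.ofPred_forall]
    exact S.measurableSet_biInter fun i _ => measurableSet_le (hX i) measurable_const
  have hmeas' : MeasurableSet {ω | (⨆ S ∈ Finset.univ.filter
      (fun S : Finset (Fin n) => S.card = n - (j + 1) + 1), ⨅ i ∈ S, X i ω) ≤ y} :=
    measurableSet_le (Measurable.iSup fun S => Measurable.iSup fun _ =>
      Measurable.iInf fun i => Measurable.iInf fun _ => hX i) measurable_const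
  change ℙ.real _ = ∑ S ∈ _, _ * ℙ.real _
  simp_rw [← integral_indicator_one hmeas', ← integral_indicator_one (hmeas _),
    ← integral_const_mul]
  rw [← integral_finsetSum]
  swap
  · exact fun S _ => ((integrable_const (1 : ℝ)).indicator (hmeas S)).const_mul _
  congr 1
  funext ω
  have hsum := sum_powerset_filter_choose_pred (Finset.univ.filter fun i => X i ω ≤ y) j
  have hpow : (Finset.univ.filter fun i => X i ω ≤ y).powerset =
      Finset.univ.filter fun S : Finset (Fin n) => ∀ i ∈ S, X i ω ≤ y := by
    ext S
    simp [Finset.subset_iff]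
  rw [hpow, Finset.sum_filter] at hsum
  simp only [Set.indicator_apply, Set.mem_ofPred_eq, Pi.one_apply,
    iSup_iInf_le_iff_le_card hkn]
  rw [← hsum, Finset.sum_filter]
  refine Finset.sum_congr rfl fun S _ => ?_
  by_cases h₁ : ∀ i ∈ S, X i ω ≤ y <;> by_cases h₂ : j + 1 ≤ S.card <;> simp [h₁, h₂]
end

section
/- If X_1, …, X_n possess cardinality symmetry, then for every k ∈ {1,…,n} and every y ∈ ℝ̄, F_{(k)}(y) = Σ_{s=0}^{n−k} C(n, s) · g_y(s). -/
open MeasureTheory Finset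

/-- The supremum over `(m + 1)`-element sets of the minimum of `x` is at most `y` iff at most `m`
values of `x` exceed `y`. -/
lemma iSup_card_iInf_le_iff {ι α : Type*} [Fintype ι] [CompleteLinearOrder α]
    (x : ι → α) (y : α) (m : ℕ) :
    (⨆ S ∈ univ.filter (fun S : Finset ι => S.card = m + 1), ⨅ i ∈ S, x i) ≤ y ↔
      (univ.filter fun i => y < x i).card ≤ m := by
  simp only [iSup_le_iff, mem_filter, mem_univ, true_and]
  constructor
  · intro h
    by_contra! hlt
    obtain ⟨S, hS, hcard⟩ := exists_subset_card_eq (Nat.succ_le_of_lt hlt)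
    have hmem : ∀ i ∈ S, y < x i := fun i hi => by simpa using hS hi
    obtain ⟨j, hj⟩ : S.Nonempty := card_pos.mp (by omega)
    have hy : y < S.inf x :=
      (Finset.lt_inf_iff ((hmem j hj).trans_le le_top)).2 hmem
    rw [Finset.inf_eq_iInf] at hy
    exact absurd (h S hcard) hy.not_ge
  · intro h S hcard
    by_contra! hlt
    have hS : S ⊆ univ.filter fun i => y < x i := fun i hi => by
      simpa using hlt.trans_le (iInf₂_le i hi)
    have := card_le_card hS
    omega

/-- under cardinality symmetry, the c.d.f. of the `k`th order statistic is
`F_{(k)}(y) = Σ_{s=0}^{n−k} C(n, s) · g_y(s)`. -/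
theorem stmt_18 {n : ℕ} (hn : 1 ≤ n) {Ω : Type*} [MeasurableSpace Ω]
    (ℙ : Measure Ω) [IsProbabilityMeasure ℙ]
    (X : Fin n → Ω → EReal) (hX : ∀ i, Measurable (X i))
    (hsym : ∀ (y : EReal) (S S' : Finset (Fin n)), S.card = S'.card →
      ℙ {ω | ∀ i, X i ω > y ↔ i ∈ S} = ℙ {ω | ∀ i, X i ω > y ↔ i ∈ S'})
    (g : EReal → ℕ → ℝ)
    (hg : ∀ (y : EReal) (S : Finset (Fin n)),
      g y S.card = (ℙ {ω | ∀ i, X i ω > y ↔ i ∈ S}).toReal)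
    (k : ℕ) (hk1 : 1 ≤ k) (hkn : k ≤ n) (y : EReal) :
    (ℙ {ω | (⨆ S ∈ Finset.univ.filter (fun S : Finset (Fin n) => S.card = n - k + 1),
        ⨅ i ∈ S, X i ω) ≤ y}).toReal =
      ∑ s ∈ Finset.range (n - k + 1), (Nat.choose n s : ℝ) * g y s := by
  have hset : {ω | (⨆ S ∈ univ.filter (fun S : Finset (Fin n) => S.card = n - k + 1),
        ⨅ i ∈ S, X i ω) ≤ y} =
      ⋃ S ∈ (range (n - k + 1)).biUnion (fun s => powersetCard s (univ : Finset (Fin n))),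
        {ω | ∀ i, X i ω > y ↔ i ∈ S} := by
    ext ω
    simp only [Set.mem_ofPred_eq, iSup_card_iInf_le_iff, Set.mem_iUnion, mem_biUnion, mem_range,
      mem_powersetCard, subset_univ, true_and, exists_prop]
    constructor
    · intro h
      exact ⟨_, ⟨_, Nat.lt_succ_of_le h, rfl⟩, by simp⟩
    · rintro ⟨S, ⟨s, hs, rfl⟩, hS⟩
      have : (univ.filter fun i => y < X i ω) = S := by
        ext i
        simpa using hS i
      rw [this]
      omega
  have hmeas : ∀ S : Finset (Fin n), MeasurableSet {ω | ∀ i, X i ω > y ↔ i ∈ S} := fun S => by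
    rw [Set.ofPred_forall]
    refine MeasurableSet.iInter fun i => ?_
    by_cases hi : i ∈ S
    · simpa [hi] using measurableSet_lt measurable_const (hX i)
    · simpa [hi] using measurableSet_le (hX i) measurable_const
  have hdisj : Pairwise fun S T : Finset (Fin n) =>
      Disjoint {ω | ∀ i, X i ω > y ↔ i ∈ S} {ω | ∀ i, X i ω > y ↔ i ∈ T} := fun S T hST => by
    refine Set.disjoint_left.2 fun ω hS hT => hST ?_
    ext i
    exact (hS i).symm.trans (hT i)
  rw [hset, measure_biUnion_finset (fun S _ T _ h => hdisj h) (fun S _ => hmeas S),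
    ENNReal.toReal_sum (fun S _ => measure_ne_top _ _),
    sum_biUnion (fun s _ t _ h => pairwise_disjoint_powersetCard _ h)]
  refine sum_congr rfl fun s _ => ?_
  have hterm : ∀ S ∈ powersetCard s (univ : Finset (Fin n)),
      (ℙ {ω | ∀ i, X i ω > y ↔ i ∈ S}).toReal = g y s := fun S hS => by
    rw [← hg, (mem_powersetCard.1 hS).2]
  rw [sum_congr rfl hterm]
  simp
end

section
/- The variables X_1, …, X_n possess cardinality symmetry if and only if for every nondecreasing set function w : 2^{{1,…,n}} → ℝ̄ and every y ∈ ℝ̄, writing Y = p_w(X_1,…,X_n), one has 1 − F_Y(y) = Σ_{s=0}^n ω̄_s(y) · [ F_{(n−s)}(y) − F_{(n−s+1)}(y) ], where ω̄_s(y) = C(n,s)^{−1} · Σ_{S ⊆ {1,…,n}, |S| = s} Ind(w(S) > y). -/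
open MeasureTheory Finset

/-- The indices whose coordinate exceeds the level `y`. -/
noncomputable def exceedSet {n : ℕ} (x : Fin n → EReal) (y : EReal) : Finset (Fin n) :=
  Finset.univ.filter (fun i => y < x i)

/-- The average of `D` over the finsets having the same cardinality as `S`. -/
noncomputable def cardAverage {n : ℕ} (D : Finset (Fin n) → ℝ) (S : Finset (Fin n)) : ℝ :=
  (Nat.choose n S.card : ℝ)⁻¹ *
    ∑ T ∈ Finset.univ.filter (fun T : Finset (Fin n) => T.card = S.card), D T

lemma subset_exceedSet_iff {n : ℕ} (x : Fin n → EReal) {y : EReal} (hy : y < ⊤)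
    (S : Finset (Fin n)) : S ⊆ exceedSet x y ↔ y < ⨅ i ∈ S, x i := by
  rw [← Finset.inf_eq_iInf, Finset.lt_inf_iff hy]
  simp [exceedSet, Finset.subset_iff]

lemma setOf_gt_iff_mem {n : ℕ} {Ω : Type*} (X : Fin n → Ω → EReal) (y : EReal)
    (S : Finset (Fin n)) :
    {ω | ∀ i, X i ω > y ↔ i ∈ S} = {ω | exceedSet (fun i => X i ω) y = S} := by
  ext ω
  simp [exceedSet, Finset.ext_iff]

lemma measurableSet_exceedSet_eq {n : ℕ} {Ω : Type*} [MeasurableSpace Ω]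
    (X : Fin n → Ω → EReal) (hX : ∀ i, Measurable (X i)) (y : EReal) (S : Finset (Fin n)) :
    MeasurableSet {ω | exceedSet (fun i => X i ω) y = S} := by
  rw [← setOf_gt_iff_mem, Set.ofPred_forall]
  refine MeasurableSet.iInter fun i => ?_
  exact (measurableSet_lt measurable_const (hX i)).iff (MeasurableSet.const _)

lemma measurableSet_finite_valued {Ω α : Type*} [Fintype α] [MeasurableSpace Ω]
    {T : Ω → α} (hT : ∀ a, MeasurableSet {ω | T ω = a}) (P : α → Prop) :
    MeasurableSet {ω | P (T ω)} := by
  have : {ω | P (T ω)} = ⋃ a ∈ {a | P a}, {ω | T ω = a} := by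
    ext ω
    simp
  rw [this]
  exact MeasurableSet.biUnion (Set.to_countable _) fun a _ => hT a

lemma measureReal_finite_valued {Ω α : Type*} [Fintype α] [MeasurableSpace Ω]
    (μ : Measure Ω) [IsFiniteMeasure μ] {T : Ω → α}
    (hT : ∀ a, MeasurableSet {ω | T ω = a}) (P : α → Prop) [DecidablePred P] :
    μ.real {ω | P (T ω)} = ∑ a ∈ Finset.univ.filter P, μ.real {ω | T ω = a} := by
  have : {ω | P (T ω)} = ⋃ a ∈ Finset.univ.filter P, {ω | T ω = a} := by
    ext ω
    simp
  rw [this, measureReal_biUnion_finset]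
  · intro a _ b _ hab
    exact Set.disjoint_left.2 fun ω ha hb => hab (ha.symm.trans hb)
  · exact fun a _ => hT a

lemma latticePolynomial_le_iff {n : ℕ} (x : Fin n → EReal) (y : EReal)
    (w : Finset (Fin n) → EReal) (hw : ∀ S T : Finset (Fin n), S ⊆ T → w S ≤ w T) :
    (⨆ S : Finset (Fin n), (w S ⊓ ⨅ i ∈ S, x i)) ≤ y ↔ ¬ y < w (exceedSet x y) := by
  rw [← not_lt, not_iff_not, lt_iSup_iff]
  constructor
  · rintro ⟨S, hS⟩
    obtain ⟨h₁, h₂⟩ := lt_inf_iff.1 hS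
    exact h₁.trans_le (hw _ _ ((subset_exceedSet_iff x (h₁.trans_le le_top) S).2 h₂))
  · intro h
    exact ⟨_, lt_inf_iff.2
      ⟨h, (subset_exceedSet_iff x (h.trans_le le_top) _).1 subset_rfl⟩⟩

lemma orderStatistic_le_iff {n m : ℕ} (hm : 1 ≤ m) (x : Fin n → EReal) (y : EReal) :
    (⨆ S ∈ Finset.univ.filter (fun S : Finset (Fin n) => S.card = m), ⨅ i ∈ S, x i) ≤ y ↔
      (exceedSet x y).card < m := by
  rcases eq_or_ne y ⊤ with rfl | hy
  · simp [exceedSet]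
    omega
  rw [← not_lt, not_iff_comm, not_lt]
  simp only [lt_iSup_iff, Finset.mem_filter, Finset.mem_univ, true_and, exists_prop,
    ← subset_exceedSet_iff x hy.lt_top]
  constructor
  · intro h
    obtain ⟨S, h₁, h₂⟩ := Finset.exists_subset_card_eq h
    exact ⟨S, h₂, h₁⟩
  · rintro ⟨S, rfl, h⟩
    exact Finset.card_le_card h

lemma sum_cardAverage {n : ℕ} (D : Finset (Fin n) → ℝ) (P : Finset (Fin n) → Prop)
    [DecidablePred P] :
    ∑ s ∈ Finset.range (n + 1),
      ((Nat.choose n s : ℝ)⁻¹ *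
          ∑ S ∈ Finset.univ.filter (fun S : Finset (Fin n) => S.card = s),
            (if P S then (1 : ℝ) else 0)) *
        ∑ S ∈ Finset.univ.filter (fun S : Finset (Fin n) => S.card = s), D S =
      ∑ S ∈ Finset.univ.filter P, cardAverage D S := by
  rw [Finset.sum_filter, ← Finset.sum_fiberwise_of_maps_to
    (g := Finset.card) (t := Finset.range (n + 1))
    (fun S _ => Finset.mem_range.2 (Nat.lt_succ_of_le (by simpa using S.card_le_univ)))]
  refine Finset.sum_congr rfl fun s _ => ?_
  rw [mul_right_comm, Finset.mul_sum]
  refine Finset.sum_congr rfl fun S hS => ?_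
  obtain rfl := (Finset.mem_filter.1 hS).2
  simp [cardAverage]

lemma cardAverage_eq_self {n : ℕ} {D : Finset (Fin n) → ℝ}
    (hD : ∀ S S' : Finset (Fin n), S.card = S'.card → D S = D S') (S : Finset (Fin n)) :
    cardAverage D S = D S := by
  have hcard : (Finset.univ.filter (fun T : Finset (Fin n) => T.card = S.card)).card =
      n.choose S.card := by
    rw [Finset.univ_filter_card_eq, Finset.card_powersetCard, Finset.card_univ, Fintype.card_fin]
  have hpos : (n.choose S.card : ℝ) ≠ 0 := by
    exact_mod_cast (Nat.choose_pos (by simpa using S.card_le_univ)).ne'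
  rw [cardAverage, Finset.sum_congr rfl fun T hT => hD T S (Finset.mem_filter.1 hT).2,
    Finset.sum_const, hcard, nsmul_eq_mul, inv_mul_cancel_left₀ hpos]

lemma cardAverage_congr {n : ℕ} (D : Finset (Fin n) → ℝ) {S S' : Finset (Fin n)}
    (h : S.card = S'.card) : cardAverage D S = cardAverage D S' := by
  rw [cardAverage, cardAverage, h]

/-- Functions on finsets whose sums over all upper sets agree are equal. -/
lemma eq_of_sum_upperSet_eq {α : Type*} [Fintype α] [DecidableEq α] {D E : Finset α → ℝ}
    (h : ∀ (P : Finset α → Prop) [DecidablePred P], (∀ S T, S ⊆ T → P S → P T) →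
      ∑ S ∈ Finset.univ.filter P, D S = ∑ S ∈ Finset.univ.filter P, E S)
    (S : Finset α) : D S = E S := by
  have h₁ := h (fun T => S ⊆ T) fun _ _ hT hS => hS.trans hT
  have h₂ := h (fun T => S ⊂ T) fun _ _ hT hS => hS.trans_subset hT
  have hins : Finset.univ.filter (fun T => S ⊆ T) =
      insert S (Finset.univ.filter (fun T => S ⊂ T)) := by
    ext T
    simp only [Finset.mem_filter, Finset.mem_univ, true_and, Finset.mem_insert,
      subset_iff_ssubset_or_eq]
    rw [or_comm, eq_comm]
  rw [hins, Finset.sum_insert (by simp), Finset.sum_insert (by simp), h₂] at h₁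
  exact add_right_cancel h₁

/-- `X_1, …, X_n` possess cardinality symmetry iff for every nondecreasing
set function `w` and every `y`, writing `Y = p_w(X_1, …, X_n)`,
`1 − F_Y(y) = Σ_{s=0}^n ω̄_s(y) · [F_{(n−s)}(y) − F_{(n−s+1)}(y)]` with
`ω̄_s(y) = C(n,s)⁻¹ · Σ_{|S| = s} Ind(w(S) > y)`.  Here `F_{(k)}` is the c.d.f. of the
`k`th order statistic, with `F_{(0)} ≡ 1` and `F_{(n+1)} ≡ 0`. -/
theorem stmt_19 {n : ℕ} (hn : 1 ≤ n) {Ω : Type*} [MeasurableSpace Ω]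
    (ℙ : Measure Ω) [IsProbabilityMeasure ℙ]
    (X : Fin n → Ω → EReal) (hX : ∀ i, Measurable (X i))
    (F : ℕ → EReal → ℝ)
    (hF : ∀ k, 1 ≤ k → k ≤ n → ∀ y, F k y =
      (ℙ {ω | (⨆ S ∈ Finset.univ.filter (fun S : Finset (Fin n) => S.card = n - k + 1),
          ⨅ i ∈ S, X i ω) ≤ y}).toReal)
    (hF0 : ∀ y, F 0 y = 1) (hFtop : ∀ y, F (n + 1) y = 0) :
    (∀ (y : EReal) (S S' : Finset (Fin n)), S.card = S'.card →
        ℙ {ω | ∀ i, X i ω > y ↔ i ∈ S} = ℙ {ω | ∀ i, X i ω > y ↔ i ∈ S'}) ↔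
      (∀ w : Finset (Fin n) → EReal, (∀ S T : Finset (Fin n), S ⊆ T → w S ≤ w T) →
        ∀ y : EReal,
          1 - (ℙ {ω | (⨆ S : Finset (Fin n), (w S ⊓ ⨅ i ∈ S, X i ω)) ≤ y}).toReal =
            ∑ s ∈ Finset.range (n + 1),
              ((Nat.choose n s : ℝ)⁻¹ *
                  ∑ S ∈ Finset.univ.filter (fun S : Finset (Fin n) => S.card = s),
                    (if w S > y then (1 : ℝ) else 0)) *
                (F (n - s) y - F (n - s + 1) y)) := by
  let D : EReal → Finset (Fin n) → ℝ := fun y S =>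
    ℙ.real {ω | exceedSet (fun i => X i ω) y = S}
  have hmeas := measurableSet_exceedSet_eq X hX
  have hFcard : ∀ y m, m ≤ n + 1 → F (n + 1 - m) y =
      ∑ S ∈ Finset.univ.filter (fun S : Finset (Fin n) => S.card < m), D y S := by
    intro y m hm
    rw [← measureReal_finite_valued ℙ (hmeas y) (fun S => S.card < m)]
    rcases Nat.eq_zero_or_pos m with rfl | hm0
    · simpa using hFtop y
    rcases hm.eq_or_lt with rfl | hmn
    · have : {ω | (exceedSet (fun i => X i ω) y).card < n + 1} = Set.univ :=
        Set.eq_univ_of_forall fun ω =>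
          Nat.lt_succ_of_le (by simpa using (exceedSet (fun i => X i ω) y).card_le_univ)
      rw [this]
      simpa using hF0 y
    · rw [hF _ (by omega) (by omega), show n - (n + 1 - m) + 1 = m by omega]
      simp_rw [orderStatistic_le_iff hm0]
      rfl
  have hFdiff : ∀ y, ∀ s ∈ Finset.range (n + 1), F (n - s) y - F (n - s + 1) y =
      ∑ S ∈ Finset.univ.filter (fun S : Finset (Fin n) => S.card = s), D y S := by
    intro y s hs
    have hs' := Finset.mem_range.1 hs
    rw [show n - s + 1 = n + 1 - s by omega, show n - s = n + 1 - (s + 1) by omega,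
      hFcard y s (by omega), hFcard y (s + 1) (by omega), sub_eq_iff_eq_add]
    simp only [Finset.sum_filter, ← Finset.sum_add_distrib]
    refine Finset.sum_congr rfl fun S _ => ?_
    rcases lt_trichotomy S.card s with h | h | h
    · simp [h, h.ne, h.le]
    · simp [h]
    · simp [h.ne', h.not_gt, h.not_ge]
  have hY : ∀ w : Finset (Fin n) → EReal, (∀ S T : Finset (Fin n), S ⊆ T → w S ≤ w T) →
      ∀ y, 1 - (ℙ {ω | (⨆ S : Finset (Fin n), (w S ⊓ ⨅ i ∈ S, X i ω)) ≤ y}).toReal =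
        ∑ S ∈ Finset.univ.filter (fun S => w S > y), D y S := by
    intro w hw y
    simp_rw [latticePolynomial_le_iff _ y w hw]
    rw [← measureReal_finite_valued ℙ (hmeas y) (fun S => w S > y), sub_eq_iff_eq_add,
      add_comm]
    have := probReal_compl_eq_one_sub (μ := ℙ)
      (measurableSet_finite_valued (hmeas y) (fun S => w S > y))
    rw [Set.compl_ofPred] at this
    simp only [gt_iff_lt, measureReal_def] at this ⊢
    rw [this]
    ring
  have hrhs : ∀ (w : Finset (Fin n) → EReal) (y : EReal),
      ∑ s ∈ Finset.range (n + 1),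
        ((Nat.choose n s : ℝ)⁻¹ *
            ∑ S ∈ Finset.univ.filter (fun S : Finset (Fin n) => S.card = s),
              (if w S > y then (1 : ℝ) else 0)) *
          (F (n - s) y - F (n - s + 1) y) =
        ∑ S ∈ Finset.univ.filter (fun S => w S > y), cardAverage (D y) S := by
    intro w y
    rw [← sum_cardAverage]
    exact Finset.sum_congr rfl fun s hs => by rw [hFdiff y s hs]
  simp only [setOf_gt_iff_mem]
  constructor
  · intro hsym w hw y
    rw [hY w hw, hrhs]
    refine Finset.sum_congr rfl fun S _ => (cardAverage_eq_self (fun S S' h => ?_) S).symm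
    exact congrArg ENNReal.toReal (hsym y S S' h)
  · intro h y S S' hS
    rcases eq_or_ne y ⊤ with rfl | hy
    · rcases eq_or_ne S S' with rfl | hne
      · rfl
      have hS0 : ∅ ≠ S := by
        rintro rfl
        exact hne (Finset.card_eq_zero.1 hS.symm).symm
      have hS0' : ∅ ≠ S' := by
        rintro rfl
        exact hne (Finset.card_eq_zero.1 hS)
      simp [exceedSet, hS0, hS0']
    have key : ∀ T, D y T = cardAverage (D y) T := by
      refine eq_of_sum_upperSet_eq fun P _ hP => ?_
      have hw : ∀ S T : Finset (Fin n), S ⊆ T →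
          (if P S then (⊤ : EReal) else ⊥) ≤ if P T then ⊤ else ⊥ := by
        intro S T hST
        by_cases hPS : P S
        · simp [hPS, hP S T hST hPS]
        · simp [hPS]
      have hiff : ∀ S, (if P S then (⊤ : EReal) else ⊥) > y ↔ P S := by
        intro S
        by_cases hPS : P S <;> simp [hPS, hy.lt_top]
      have := h _ hw y
      rw [hY _ hw, hrhs] at this
      simpa only [hiff] using this
    have hD : D y S = D y S' := by
      rw [key S, key S', cardAverage_congr _ hS]
    exact (ENNReal.toReal_eq_toReal_iff' (measure_ne_top _ _) (measure_ne_top _ _)).1 hD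
end
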